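/- (Proposition 2.) Let m ≥ 1, M > 0, let ρ_prev be a partition of {1, …, m}, and let γ ∈ {0,1}^m with S(γ) = {i : γ_i = 1}. Call a partition λ of {1, …, m} compatible with ρ_prev given γ if λ|_{S(γ)} = ρ_prev|_{S(γ)}. Define the conditional probability of λ given γ and ρ_prev as p_m(λ)·I[λ compatible] / Σ_{λ' compatible} p_m(λ'). Then this conditional probability equals p_m(λ) / p_{|S(γ)|}(λ|_{S(γ)}) whenever λ is compatible with ρ_prev given γ, and equals 0 otherwise. -/

import Mathlib

open Finset

noncomputable section

/-- CRP(M) probability of a partition of a finite set `s` of `n = s.card` elements: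
`p_n(ρ) = M^k ∏_j (|S_j| - 1)! / ∏_{i=1}^n (M + i - 1)`. -/
def crp {α : Type*} [DecidableEq α] (M : ℝ) {s : Finset α} (P : Finpartition s) : ℝ :=
  (M ^ P.parts.card * ∏ b ∈ P.parts, (Nat.factorial (b.card - 1) : ℝ)) /
    ∏ i ∈ Finset.range s.card, (M + i)

/-- Restriction of a partition of `s` to a subset `A ⊆ s`: the clusters are the
nonempty intersections of the clusters with `A`. -/
def restrictPart {α : Type*} [DecidableEq α] {s : Finset α} (P : Finpartition s)
    (A : Finset α) (hA : A ⊆ s) : Finpartition A :=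
  Finpartition.ofErase (P.parts.image (· ∩ A))
    (by
      rw [Finset.supIndep_iff_pairwiseDisjoint]
      rintro x hx y hy hxy
      simp only [coe_image, Set.mem_image, mem_coe] at hx hy
      obtain ⟨p, hp, rfl⟩ := hx
      obtain ⟨q, hq, rfl⟩ := hy
      have hpq : p ≠ q := by rintro rfl; exact hxy rfl
      exact (P.disjoint hp hq hpq).mono inter_subset_left inter_subset_left)
    (by
      rw [Finset.sup_image]
      have : (P.parts.sup (id ∘ (· ∩ A))) = P.parts.sup id ⊓ A := by
        rw [Finset.sup_inf_distrib_right]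
        rfl
      rw [this, P.sup_parts]
      exact inf_eq_right.mpr hA)

/-- The set `S(γ) = {i : γ i = 1}`. -/
def gammaSet {m : ℕ} (γ : Fin m → Bool) : Finset (Fin m) :=
  Finset.univ.filter (fun i => γ i = true)

/-- The one-step tRPM transition kernel `K_α(ρ, λ)`. -/
def tK {m : ℕ} (M a : ℝ) (ρ lam : Finpartition (Finset.univ : Finset (Fin m))) : ℝ :=
  ∑ γ : Fin m → Bool,
    (∏ i, if γ i then a else 1 - a) *
      (if restrictPart lam (gammaSet γ) (Finset.subset_univ _) =
          restrictPart ρ (gammaSet γ) (Finset.subset_univ _) then 1 else 0) *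
      (crp M lam / crp M (restrictPart lam (gammaSet γ) (Finset.subset_univ _)))

end

theorem mem_restrictPart {α : Type*} [DecidableEq α] {s : Finset α} (P : Finpartition s)
    (A : Finset α) (hA : A ⊆ s) (c : Finset α) :
    c ∈ (restrictPart P A hA).parts ↔ c ≠ ∅ ∧ ∃ p ∈ P.parts, p ∩ A = c := by
  simp [restrictPart, Finpartition.ofErase]

theorem restrictPart_self {α : Type*} [DecidableEq α] {s : Finset α} (P : Finpartition s)
    (hA : s ⊆ s) : restrictPart P s hA = P := by
  ext c
  rw [mem_restrictPart]
  constructor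
  · rintro ⟨_, p, hp, rfl⟩
    rwa [inter_eq_left.mpr (P.le hp)]
  · intro hc
    exact ⟨(P.nonempty_of_mem_parts hc).ne_empty, c, hc, inter_eq_left.mpr (P.le hc)⟩

theorem restrictPart_trans {α : Type*} [DecidableEq α] {s t A : Finset α} (P : Finpartition s)
    (ht : t ⊆ s) (hA : A ⊆ t) (hA' : A ⊆ s) :
    restrictPart (restrictPart P t ht) A hA = restrictPart P A hA' := by
  ext c
  simp only [mem_restrictPart]
  constructor
  · rintro ⟨hc, p, ⟨_, q, hq, rfl⟩, rfl⟩
    exact ⟨hc, q, hq, by rw [inter_assoc, inter_eq_right.mpr hA]⟩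
  · rintro ⟨hc, q, hq, rfl⟩
    refine ⟨hc, q ∩ t, ⟨?_, q, hq, rfl⟩, by rw [inter_assoc, inter_eq_right.mpr hA]⟩
    rintro h
    apply hc
    rw [← inter_eq_right.mpr hA, ← inter_assoc, h, empty_inter]

/-- Add `a` to the block `b` (a new block when `b = ∅`). -/
def extPart {α : Type*} [DecidableEq α] {t : Finset α} (a : α) (ha : a ∉ t)
    (Q : Finpartition t) (b : Finset α) (hb : b ∈ insert ∅ Q.parts) :
    Finpartition (insert a t) where
  parts := insert (insert a b) (Q.parts.erase b)
  supIndep := by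
    have hsub : ∀ c ∈ Q.parts, a ∉ c := fun c hc h => ha (Q.le hc h)
    have key : ∀ c ∈ Q.parts.erase b, Disjoint (insert a b) c := by
      intro c hc
      rw [mem_erase] at hc
      rw [disjoint_insert_left]
      refine ⟨hsub c hc.2, ?_⟩
      rcases mem_insert.mp hb with rfl | hb
      · exact disjoint_empty_left _
      · exact Q.disjoint hb hc.2 (Ne.symm hc.1)
    rw [Finset.supIndep_iff_pairwiseDisjoint]
    intro x hx y hy hxy
    simp only [coe_insert, Set.mem_insert_iff, mem_coe] at hx hy
    rcases hx with rfl | hx <;> rcases hy with rfl | hy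
    · exact absurd rfl hxy
    · exact key y hy
    · exact (key x hx).symm
    · exact Q.disjoint (mem_of_mem_erase hx) (mem_of_mem_erase hy) hxy
  sup_parts := by
    have h1 : b ∪ (Q.parts.erase b).sup id = t := by
      rcases mem_insert.mp hb with rfl | hb
      · rw [erase_eq_of_notMem (show ∅ ∉ Q.parts from Q.bot_notMem), Q.sup_parts, empty_union]
      · conv_rhs => rw [← Q.sup_parts, ← insert_erase hb, sup_insert]
        rfl
    rw [sup_insert]
    conv_rhs => rw [← h1]
    simp
  bot_notMem := by
    simp only [mem_insert, mem_erase, not_or]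
    exact ⟨fun h => (insert_ne_empty a b) h.symm, fun h => Q.bot_notMem h.2⟩

theorem prod_pos_aux {M : ℝ} (hM : 0 < M) (n : ℕ) : 0 < ∏ i ∈ Finset.range n, (M + i) :=
  prod_pos fun i _ => by positivity

theorem crp_pos {α : Type*} [DecidableEq α] {M : ℝ} (hM : 0 < M) {s : Finset α}
    (P : Finpartition s) : 0 < crp M P := by
  have := prod_pos_aux hM s.card
  have h2 : 0 < ∏ b ∈ P.parts, (Nat.factorial (b.card - 1) : ℝ) :=
    prod_pos fun b _ => by positivity
  unfold crp
  positivity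

theorem crp_ext {α : Type*} [DecidableEq α] {M : ℝ} (hM : 0 < M) {t : Finset α} (a : α)
    (ha : a ∉ t) (Q : Finpartition t) (b : Finset α) (hb : b ∈ insert ∅ Q.parts) :
    crp M (extPart a ha Q b hb) =
      crp M Q * ((if b = ∅ then M else (b.card : ℝ)) / (M + t.card)) := by
  have h0 := (prod_pos_aux hM t.card).ne'
  have h1 : M + (t.card : ℝ) ≠ 0 := by positivity
  have hsub : ∀ c ∈ Q.parts, a ∉ c := fun c hc h => ha (Q.le hc h)
  have hn : insert a b ∉ Q.parts.erase b := fun h =>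
    hsub _ (mem_of_mem_erase h) (mem_insert_self a b)
  have hab : a ∉ b := by
    rcases mem_insert.mp hb with rfl | hb
    · simp
    · exact hsub b hb
  unfold crp
  have hp : (extPart a ha Q b hb).parts = insert (insert a b) (Q.parts.erase b) := rfl
  rw [hp, card_insert_of_notMem hn, prod_insert hn, card_insert_of_notMem ha, prod_range_succ,
    card_insert_of_notMem hab, Nat.add_sub_cancel]
  rcases mem_insert.mp hb with rfl | hb
  · rw [erase_eq_of_notMem (show ∅ ∉ Q.parts from Q.bot_notMem)]
    simp only [card_empty, Nat.factorial_zero, if_true]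
    field_simp
    simp [pow_succ, mul_comm]
  · have hne := Q.nonempty_of_mem_parts hb
    rw [if_neg hne.ne_empty, card_erase_add_one hb, ← mul_prod_erase Q.parts _ hb]
    obtain ⟨k, hk⟩ : ∃ k, b.card = k + 1 := ⟨b.card - 1, by have := hne.card_pos; omega⟩
    rw [hk, Nat.factorial_succ]
    push_cast
    field_simp

theorem one_step {α : Type*} [DecidableEq α] {M : ℝ} (hM : 0 < M) {t : Finset α} (a : α)
    (ha : a ∉ t) (ht : t ⊆ insert a t) (Q : Finpartition t) :
    (∑ P : Finpartition (insert a t), if restrictPart P t ht = Q then crp M P else 0)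
      = crp M Q := by
  have hsub : ∀ c ∈ Q.parts, a ∉ c := fun c hc h => ha (Q.le hc h)
  have hsum : ∑ b ∈ insert ∅ Q.parts,
      crp M Q * ((if b = ∅ then M else (b.card : ℝ)) / (M + t.card)) = crp M Q := by
    rw [← mul_sum, ← sum_div, sum_insert (show ∅ ∉ Q.parts from Q.bot_notMem), if_pos rfl]
    have : ∑ b ∈ Q.parts, (if b = ∅ then M else (b.card : ℝ)) = t.card := by
      rw [← Q.sum_card_parts]
      push_cast
      exact sum_congr rfl fun b hb => if_neg (Q.nonempty_of_mem_parts hb).ne_empty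
    rw [this, div_self (by positivity), mul_one]
  rw [← sum_filter, ← hsum]
  symm
  refine sum_bij (fun b hb => extPart a ha Q b hb) ?_ ?_ ?_ ?_
  · intro b hb
    have hbt : b ⊆ t := by
      rcases mem_insert.mp hb with rfl | hb
      · simp
      · exact Q.le hb
    have hab : insert a b ∩ t = b := by
      rw [insert_inter_of_notMem ha, inter_eq_left.mpr hbt]
    simp only [mem_filter, mem_univ, true_and]
    ext c
    rw [mem_restrictPart]
    simp only [extPart, mem_insert, mem_erase]
    constructor
    · rintro ⟨hc, p, rfl | ⟨_, hp⟩, rfl⟩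
      · rw [hab] at hc ⊢
        exact (mem_insert.mp hb).resolve_left hc
      · rwa [inter_eq_left.mpr (Q.le hp)]
    · intro hc
      refine ⟨(Q.nonempty_of_mem_parts hc).ne_empty, ?_⟩
      by_cases h : c = b
      · exact ⟨insert a b, Or.inl rfl, by rw [hab, h]⟩
      · exact ⟨c, Or.inr ⟨h, hc⟩, inter_eq_left.mpr (Q.le hc)⟩
  · intro b hb b' hb' h
    have hA : ∀ b ∈ insert ∅ Q.parts, a ∉ b := by
      intro b hb
      rcases mem_insert.mp hb with rfl | hb
      · simp
      · exact hsub b hb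
    have h1 : insert a b ∈ (extPart a ha Q b' hb').parts := by
      have h : extPart a ha Q b hb = extPart a ha Q b' hb' := h
      rw [← h]; exact mem_insert_self _ _
    simp only [extPart, mem_insert, mem_erase] at h1
    rcases h1 with h1 | h1
    · rw [← erase_insert (hA b hb), h1, erase_insert (hA b' hb')]
    · exact absurd (mem_insert_self a b) (hsub _ h1.2)
  · intro P hP
    simp only [mem_filter, mem_univ, true_and] at hP
    obtain ⟨q, hq, haq⟩ := P.exists_mem (mem_insert_self a t)
    have hu : ∀ p ∈ P.parts, p ≠ q → a ∉ p := fun p hp hpq h =>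
      disjoint_left.mp (P.disjoint hp hq hpq) h haq
    have hpt : ∀ p ∈ P.parts, p ≠ q → p ∩ t = p := fun p hp hpq =>
      inter_eq_left.mpr ((subset_insert_iff_of_notMem (hu p hp hpq)).mp (P.le hp))
    have hqt : q ∩ t = q.erase a := by
      ext x
      have : x ∈ q → x ∈ insert a t := fun h => P.le hq h
      simp only [mem_inter, mem_erase, mem_insert] at this ⊢
      constructor
      · rintro ⟨h, h'⟩
        exact ⟨fun e => ha (e ▸ h'), h⟩
      · rintro ⟨h, h'⟩
        exact ⟨h', (this h').resolve_left h⟩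
    have hQ : ∀ c, c ∈ Q.parts ↔ c ≠ ∅ ∧ ∃ p ∈ P.parts, p ∩ t = c := by
      intro c; rw [← hP, mem_restrictPart]
    have hb : q.erase a ∈ insert ∅ Q.parts := by
      rw [mem_insert, hQ]
      by_cases h : q.erase a = ∅
      · exact Or.inl h
      · exact Or.inr ⟨h, q, hq, hqt⟩
    refine ⟨q.erase a, hb, ?_⟩
    ext c
    simp only [extPart, mem_insert, mem_erase, insert_erase haq, hQ]
    constructor
    · rintro (rfl | ⟨h, hc, p, hp, rfl⟩)
      · exact hq
      · have hpq : p ≠ q := by rintro rfl; exact h hqt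
        rwa [hpt p hp hpq]
    · intro hc
      by_cases h : c = q
      · exact Or.inl h
      · refine Or.inr ⟨?_, (P.nonempty_of_mem_parts hc).ne_empty, c, hc, hpt c hc h⟩
        intro h2
        obtain ⟨x, hx⟩ := P.nonempty_of_mem_parts hc
        exact disjoint_left.mp (P.disjoint hc hq h) hx (mem_of_mem_erase (h2 ▸ hx))
  · intro b hb
    exact (crp_ext hM a ha Q b hb).symm

theorem crp_marginal {α : Type*} [DecidableEq α] {M : ℝ} (hM : 0 < M) (A : Finset α)
    (Q : Finpartition A) (n : ℕ) : ∀ (s : Finset α) (hA : A ⊆ s), (s \ A).card = n →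
    (∑ P : Finpartition s, if restrictPart P A hA = Q then crp M P else 0) = crp M Q := by
  induction n with
  | zero =>
    intro s hA h
    have : s = A := subset_antisymm (sdiff_eq_empty_iff_subset.mp (card_eq_zero.mp h)) hA
    subst this
    simp [restrictPart_self]
  | succ n ih =>
    intro s hA h
    obtain ⟨a, has⟩ : (s \ A).Nonempty := card_pos.mp (by omega)
    obtain ⟨has, haA⟩ := mem_sdiff.mp has
    obtain ⟨t, hat, rfl⟩ : ∃ t, a ∉ t ∧ insert a t = s :=
      ⟨s.erase a, notMem_erase a s, insert_erase has⟩
    have hAt : A ⊆ t := (subset_insert_iff_of_notMem haA).mp hA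
    have hcard : (t \ A).card = n := by
      rw [insert_sdiff_of_notMem _ haA, card_insert_of_notMem (by simp [hat])] at h
      omega
    rw [← ih t hAt hcard]
    have ht : t ⊆ insert a t := subset_insert a t
    have : ∀ R : Finpartition t, (if restrictPart R A hAt = Q then crp M R else 0) =
        ∑ P : Finpartition (insert a t),
          if restrictPart P t ht = R then
            (if restrictPart P A hA = Q then crp M P else 0) else 0 := by
      intro R
      rw [← one_step hM a hat ht R]
      split_ifs with hR
      · refine sum_congr rfl fun P _ => ?_
        split_ifs with h1 h2
        · rfl
        · exact absurd (by rw [← restrictPart_trans P ht hAt hA, h1, hR]) h2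
        · rfl
      · symm
        refine sum_eq_zero fun P _ => ?_
        split_ifs with h1 h2
        · exact absurd (by rw [← h1, restrictPart_trans P ht hAt hA, h2]) hR
        · rfl
        · rfl
    simp_rw [this]
    rw [sum_comm]
    simp

/-- Proposition 2: the conditional probability of `lam` given `γ` and
`ρprev` (CRP weight restricted to compatible partitions, renormalized) equals
`p_m(lam) / p_{|S(γ)|}(lam|_{S(γ)})` when `lam` is compatible with `ρprev` given `γ`,
and `0` otherwise. -/
theorem statement1 (m : ℕ) (hm : 1 ≤ m) (M : ℝ) (hM : 0 < M)
    (ρprev lam : Finpartition (Finset.univ : Finset (Fin m))) (γ : Fin m → Bool) :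
    (crp M lam *
        (if restrictPart lam (gammaSet γ) (Finset.subset_univ _) =
            restrictPart ρprev (gammaSet γ) (Finset.subset_univ _) then 1 else 0)) /
      (∑ lam' : Finpartition (Finset.univ : Finset (Fin m)),
        if restrictPart lam' (gammaSet γ) (Finset.subset_univ _) =
            restrictPart ρprev (gammaSet γ) (Finset.subset_univ _) then crp M lam' else 0) =
    (if restrictPart lam (gammaSet γ) (Finset.subset_univ _) =
        restrictPart ρprev (gammaSet γ) (Finset.subset_univ _) then
      crp M lam / crp M (restrictPart lam (gammaSet γ) (Finset.subset_univ _))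
    else 0) := by
  rw [crp_marginal hM (gammaSet γ) _ _ Finset.univ (Finset.subset_univ _) rfl]
  split_ifs with h
  · rw [mul_one, h]
  · rw [mul_zero, zero_div]
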